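/- Let X ⊆ P^n have CBP(r) and lie on a skew plane configuration 𝒫 = 𝒫_1 ∪ ⋯ ∪ 𝒫_k with X ∩ 𝒫_i ≠ ∅ for all i. Then either every plane 𝒫_i contains at least max{k, r+2} points of X, or some plane 𝒫_i contains fewer than k points of X and k ≥ r + 2. -/

import Mathlib

open MvPolynomial Module

variable {K : Type*} [Field K] [CharZero K] {n : ℕ}

/-- Projective `n`-space over `K`, as the projectivization of `K^{n+1}`. -/
abbrev Proj (K : Type*) [Field K] (n : ℕ) := Projectivization K (Fin (n+1) → K)

/-- A polynomial vanishes at a projective point if it vanishes at every representative. -/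
def vanishesAt (f : MvPolynomial (Fin (n+1)) K) (p : Proj K n) : Prop :=
  ∀ (v : Fin (n+1) → K) (hv : v ≠ 0), Projectivization.mk K v hv = p →
    MvPolynomial.eval v f = 0

/-- `X` has the Cayley–Bacharach property of degree `r`: every hypersurface of degree `r`
containing all but one point of `X` contains all of `X`. -/
def hasCBP (X : Finset (Proj K n)) (r : ℕ) : Prop :=
  ∀ p ∈ X, ∀ f : MvPolynomial (Fin (n+1)) K, f.IsHomogeneous r →
    (∀ q ∈ X, q ≠ p → vanishesAt f q) → vanishesAt f p

/-- The set of projective points lying on the linear subspace given by a submodule `W`. -/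
def projPoints (W : Submodule K (Fin (n+1) → K)) : Set (Proj K n) :=
  {p | p.submodule ≤ W}

/-- Evaluation of degree-`i` forms at (representatives of) the points of `X`. -/
noncomputable def evalMap (X : Finset (Proj K n)) (i : ℕ) :
    (MvPolynomial.homogeneousSubmodule (Fin (n+1)) K i) →ₗ[K] (X → K) :=
  (LinearMap.pi fun p : X =>
    (MvPolynomial.aeval (Projectivization.rep (p : Proj K n))).toLinearMap).comp
    (Submodule.subtype _)

/-- The Hilbert function of `X`: the dimension of the degree-`i` piece of the homogeneous
coordinate ring of `X`, computed as the rank of the evaluation map. -/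
noncomputable def HF (X : Finset (Proj K n)) (i : ℕ) : ℕ :=
  Module.finrank K (LinearMap.range (evalMap X i))

/-- The Hilbert function extended to integers (zero in negative degrees). -/
noncomputable def hfZ (X : Finset (Proj K n)) (i : ℤ) : ℕ :=
  if 0 ≤ i then HF X i.toNat else 0

/-- The regularity index of `X`: the least degree where the Hilbert function reaches `|X|`. -/
noncomputable def regIndex (X : Finset (Proj K n)) : ℕ :=
  sInf {i | HF X i = X.card}

/-- The initial degree `α_{Y/X}` of `I_{Y/X} = I_Y / I_X ⊆ R = P/I_X`: the least degree of a
form vanishing on `Y` but not on all of `X`. -/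
noncomputable def alphaDeg (X Y : Finset (Proj K n)) : ℕ :=
  sInf {k | ∃ f : MvPolynomial (Fin (n+1)) K, f.IsHomogeneous k ∧
    (∀ q ∈ Y, vanishesAt f q) ∧ ∃ p ∈ X, ¬ vanishesAt f p}

/-- The points of `X` lying in a set `S`. -/
noncomputable def interF (X : Finset (Proj K n)) (S : Set (Proj K n)) : Finset (Proj K n) :=
  @Finset.filter _ (fun p => p ∈ S) (Classical.decPred _) X

/-- The points of `X` not lying in a set `S`. -/
noncomputable def diffF (X : Finset (Proj K n)) (S : Set (Proj K n)) : Finset (Proj K n) :=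
  @Finset.filter _ (fun p => p ∉ S) (Classical.decPred _) X

/-- A plane configuration: a union of `k` distinct positive-dimensional linear subspaces
of `ℙ^n` (a projective linear subspace is positive-dimensional when its defining submodule
has vector-space dimension at least `2`). -/
structure PlaneConfig (K : Type*) [Field K] (n : ℕ) where
  k : ℕ
  planes : Fin k → Submodule K (Fin (n+1) → K)
  injective : Function.Injective planes
  posdim : ∀ i, 2 ≤ Module.finrank K (planes i)

/-- The set of points of a plane configuration. -/
def PlaneConfig.points (P : PlaneConfig K n) : Set (Proj K n) :=
  ⋃ i, projPoints (P.planes i)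

/-- The dimension of a plane configuration: the sum of the (projective) dimensions of
its components. -/
noncomputable def PlaneConfig.dim (P : PlaneConfig K n) : ℕ :=
  ∑ i, (Module.finrank K (P.planes i) - 1)

/-- A plane configuration is skew if its components are pairwise disjoint. -/
def PlaneConfig.isSkew (P : PlaneConfig K n) : Prop :=
  ∀ i j, i ≠ j → P.planes i ⊓ P.planes j = ⊥

/-- A plane configuration is split if each component is disjoint from the span of the
other components. -/
def PlaneConfig.isSplit (P : PlaneConfig K n) : Prop :=
  ∀ i, P.planes i ⊓ (⨆ j ∈ ({i}ᶜ : Set (Fin P.k)), P.planes j) = ⊥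

/-- `Z` lies on a plane configuration of dimension `d`. -/
def liesOnConfig (Z : Finset (Proj K n)) (d : ℕ) : Prop :=
  ∃ P : PlaneConfig K n, P.dim = d ∧ ↑Z ⊆ P.points

/-- The Levinson–Ullery conjecture for the pair `(d, r)`: any finite set of points with
`CBP(r)` and at most `(d+1)r + 1` points lies on a plane configuration of dimension `d`. -/
def LUConj (K : Type*) [Field K] [CharZero K] (d r : ℕ) : Prop :=
  ∀ (m : ℕ) (Z : Finset (Proj K m)), hasCBP Z r → Z.card ≤ (d+1)*r + 1 → liesOnConfig Z d


lemma exists_enum {α : Type*} (b : α) (S : Finset α) (r : ℕ) (h : S.card ≤ r) :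
    ∃ A : Fin r → α, (∀ s ∈ S, ∃ t, A t = s) ∧ ∀ t, A t = b ∨ A t ∈ S := by
  classical
  refine ⟨fun t => if h : t.1 < S.card then (S.equivFin.symm ⟨t.1, h⟩ : α) else b, ?_, ?_⟩
  · intro s hs
    refine ⟨⟨(S.equivFin ⟨s, hs⟩).1, lt_of_lt_of_le (S.equivFin ⟨s, hs⟩).2 h⟩, ?_⟩
    simp
  · intro t
    by_cases ht : t.1 < S.card
    · right
      simp only [ht, dif_pos]
      exact (S.equivFin.symm ⟨t.1, ht⟩).2
    · left
      simp [ht]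

lemma exists_linear_form {K : Type*} [Field K] {n : ℕ} (W : Submodule K (Fin (n+1) → K))
    (q : Fin (n+1) → K) (hq : q ∉ W) :
    ∃ L : MvPolynomial (Fin (n+1)) K, L.IsHomogeneous 1 ∧ (∀ v ∈ W, MvPolynomial.eval v L = 0) ∧
      MvPolynomial.eval q L ≠ 0 := by
  obtain ⟨φ, h1, h2⟩ := Submodule.exists_le_ker_of_notMem hq
  have key : ∀ v, MvPolynomial.eval v (∑ i, MvPolynomial.C (φ (Pi.single i 1)) *
      MvPolynomial.X i : MvPolynomial (Fin (n+1)) K) = φ v := by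
    intro v
    rw [φ.pi_apply_eq_sum_univ v]
    simp only [map_sum, map_mul, MvPolynomial.eval_C, MvPolynomial.eval_X, smul_eq_mul]
    refine Finset.sum_congr rfl fun i _ => ?_
    rw [mul_comm]
    congr 2
    ext j
    simp [Pi.single_apply, eq_comm]
  refine ⟨_, ?_, fun v hv => (key v).trans (h2 hv), ?_⟩
  · refine MvPolynomial.IsHomogeneous.sum _ _ _ fun i _ => ?_
    have := (MvPolynomial.isHomogeneous_C (Fin (n+1)) (φ (Pi.single i 1))).mul
      (MvPolynomial.isHomogeneous_X K i)
    simpa using this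
  · rw [key]; exact h1

theorem stmt14 (r : ℕ) (X : Finset (Proj K n)) (hCB : hasCBP X r) (P : PlaneConfig K n)
    (hskew : P.isSkew) (hsub : (↑X : Set (Proj K n)) ⊆ P.points)
    (hne : ∀ i, (interF X (projPoints (P.planes i))).Nonempty) :
    (∀ i, max P.k (r + 2) ≤ (interF X (projPoints (P.planes i))).card) ∨
    ((∃ i, (interF X (projPoints (P.planes i))).card < P.k) ∧ r + 2 ≤ P.k) := by
  classical
  by_cases hk : r + 2 ≤ P.k
  · by_cases h : ∃ i, (interF X (projPoints (P.planes i))).card < P.k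
    · exact Or.inr ⟨h, hk⟩
    · left
      intro i
      rw [max_eq_left hk]
      exact not_lt.1 fun h' => h ⟨i, h'⟩
  left
  intro i
  rw [max_eq_right (by omega)]
  by_contra hlt
  obtain ⟨q, hq⟩ := hne i
  obtain ⟨A, hA1, hA2⟩ := exists_enum (⊥ : Submodule K (Fin (n+1) → K))
    ((Finset.univ.erase i).image P.planes) r (by
      refine Finset.card_image_le.trans ?_
      rw [Finset.card_erase_of_mem (Finset.mem_univ _), Finset.card_univ, Fintype.card_fin]
      omega)
  obtain ⟨B, hB1, hB2⟩ := exists_enum (⊥ : Submodule K (Fin (n+1) → K))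
    (((interF X (projPoints (P.planes i))).erase q).image fun p => p.submodule) r (by
      refine Finset.card_image_le.trans ?_
      rw [Finset.card_erase_of_mem hq]
      omega)
  have hq' : q ∈ X ∧ q.submodule ≤ P.planes i := (@Finset.mem_filter _ _ (Classical.decPred _) _ _).1 hq
  have hrep : ∀ p : Proj K n, p.rep ∈ p.submodule := fun p => by
    rw [Projectivization.submodule_eq]; exact Submodule.mem_span_singleton_self _
  have hqP : q.rep ∈ P.planes i := hq'.2 (hrep q)
  have hAP : ∀ t, P.planes i ⊓ A t = ⊥ := by
    intro t
    rcases hA2 t with h | h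
    · simp [h]
    · obtain ⟨j, hj, hj'⟩ := Finset.mem_image.1 h
      rw [← hj']
      exact hskew i j (Finset.ne_of_mem_erase hj).symm
  have hBP : ∀ t, B t ≤ P.planes i ∧ q.rep ∉ B t := by
    intro t
    rcases hB2 t with h | h
    · simp [h, Projectivization.rep_nonzero]
    · obtain ⟨p, hp, hp'⟩ := Finset.mem_image.1 h
      have hpX : p ∈ X ∧ p.submodule ≤ P.planes i := 
        (@Finset.mem_filter _ _ (Classical.decPred _) _ _).1 (Finset.mem_of_mem_erase hp)
      rw [← hp']
      refine ⟨hpX.2, fun hm => Finset.ne_of_mem_erase hp ?_⟩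
      rw [Projectivization.submodule_eq, Submodule.mem_span_singleton] at hm
      obtain ⟨a, ha⟩ := hm
      rw [← p.mk_rep, ← q.mk_rep, eq_comm, Projectivization.mk_eq_mk_iff']
      exact ⟨a, ha⟩
  have hform : ∀ t, q.rep ∉ A t ⊔ B t := by
    intro t hm
    obtain ⟨a, ha, b, hb, hab⟩ := Submodule.mem_sup.1 hm
    have ha' : a ∈ P.planes i ⊓ A t := by
      refine ⟨?_, ha⟩
      have : a = q.rep - b := by rw [← hab]; simp
      rw [this]
      exact Submodule.sub_mem _ hqP ((hBP t).1 hb)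
    rw [hAP t, Submodule.mem_bot] at ha'
    rw [ha', zero_add] at hab
    exact (hBP t).2 (hab ▸ hb)
  choose L hL1 hL2 hL3 using fun t => exists_linear_form (A t ⊔ B t) q.rep (hform t)
  have hcb := hCB q hq'.1 (∏ t, L t) (by
      have := MvPolynomial.IsHomogeneous.prod Finset.univ L (fun _ => 1) (fun t _ => hL1 t)
      simpa using this) (by
    intro p hp hpq v hv hvp
    have hvm : v ∈ p.submodule := by
      rw [← hvp, Projectivization.submodule_mk]; exact Submodule.mem_span_singleton_self _
    suffices h : ∃ t, v ∈ A t ⊔ B t by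
      obtain ⟨t, ht⟩ := h
      rw [map_prod]
      exact Finset.prod_eq_zero (Finset.mem_univ t) (hL2 t v ht)
    obtain ⟨j, hj⟩ := Set.mem_iUnion.1 (hsub hp)
    by_cases hji : j = i
    · subst hji
      obtain ⟨t, ht⟩ := hB1 p.submodule (Finset.mem_image_of_mem _
        (Finset.mem_erase.2 ⟨hpq, (@Finset.mem_filter _ _ (Classical.decPred _) _ _).2 ⟨hp, hj⟩⟩))
      exact ⟨t, Submodule.mem_sup_right (ht ▸ hvm)⟩
    · obtain ⟨t, ht⟩ := hA1 (P.planes j) (Finset.mem_image_of_mem _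
        (Finset.mem_erase.2 ⟨hji, Finset.mem_univ _⟩))
      exact ⟨t, Submodule.mem_sup_left (ht ▸ hj hvm)⟩)
  have := hcb q.rep q.rep_nonzero q.mk_rep
  rw [map_prod, Finset.prod_eq_zero_iff] at this
  obtain ⟨t, _, ht⟩ := this
  exact hL3 t ht
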